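/- arXiv:2412.02718 — 4 statements merged into one kernel-verified Lean document; each statement's English description precedes it below -/
import Mathlib

section
/- Let w₁, w₂ be nonzero complex numbers with w₁/w₂ ∉ ℝ, and let Γ = {n·w₁ + m·w₂ : n, m ∈ ℤ} be the lattice they generate. Then for every z ∈ ℂ with z ∉ Γ, the family indexed by the nonzero lattice points w ∈ Γ \ {0} given by w ↦ 1/(z − w)² − 1/w² is summable (the defining series of the classical Weierstrass P-function converges absolutely). -/
/-- The lattice generated by `w₁` and `w₂`. -/
def latticeSet (w₁ w₂ : ℂ) : Set ℂ := {z : ℂ | ∃ n m : ℤ, z = (n : ℂ) * w₁ + (m : ℂ) * w₂}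

/-- Complex numbers with non-real ratio are linearly independent over `ℝ`. -/
theorem linearIndependent_pair_of_div_notMem_range_ofReal {w₁ w₂ : ℂ} (hw₂ : w₂ ≠ 0)
    (hratio : w₁ / w₂ ∉ Set.range ((↑) : ℝ → ℂ)) : LinearIndependent ℝ ![w₁, w₂] := by
  rw [LinearIndependent.pair_symm_iff, LinearIndependent.pair_iff' hw₂]
  rintro a rfl
  exact hratio ⟨a, by simp [hw₂]⟩

/-- A family summable over a subset of a type is summable over any smaller subset. -/
theorem Summable.subtype_mono {α E : Type*} [NormedAddCommGroup E] [CompleteSpace E]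
    {f : α → E} {p q : α → Prop} (h : Summable fun a : {a // q a} ↦ f a)
    (hpq : ∀ a, p a → q a) : Summable fun a : {a // p a} ↦ f a :=
  h.comp_injective (Subtype.impEmbedding p q hpq).injective

theorem weierstrass_summand_summable (w₁ w₂ : ℂ) (hw₁ : w₁ ≠ 0) (hw₂ : w₂ ≠ 0)
    (hratio : w₁ / w₂ ∉ Set.range ((↑) : ℝ → ℂ))
    (z : ℂ) (hz : z ∉ latticeSet w₁ w₂) :
    Summable (fun w : {w : ℂ // w ∈ latticeSet w₁ w₂ ∧ w ≠ 0} =>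
      1 / (z - (w : ℂ)) ^ 2 - 1 / (w : ℂ) ^ 2) := by
  let L : PeriodPair := ⟨w₁, w₂, linearIndependent_pair_of_div_notMem_range_ofReal hw₂ hratio⟩
  have hsum : Summable fun l : L.lattice ↦ 1 / (z - (l : ℂ)) ^ 2 - 1 / (l : ℂ) ^ 2 :=
    (L.hasSum_weierstrassP z).summable
  refine Summable.subtype_mono (f := fun w : ℂ ↦ 1 / (z - w) ^ 2 - 1 / w ^ 2) hsum ?_
  rintro w ⟨⟨n, m, h⟩, -⟩
  exact PeriodPair.mem_lattice.2 ⟨n, m, h.symm⟩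
end

section
/- Let w₁, w₂ be nonzero complex numbers with w₁/w₂ ∉ ℝ and Γ = {n·w₁ + m·w₂ : n, m ∈ ℤ}. Then the function h(z) = Σ_{w ∈ Γ\{0}} [1/(z−w)² − 1/w²] (defined as a tsum) is complex-differentiable (analytic) on an open neighborhood of 0 and satisfies h(0) = 0; equivalently, P(z) − 1/z² extends holomorphically through the origin with value 0, so P has a pole of order exactly 2 at 0 with principal part 1/z². -/
/-- The series part of the classical Weierstrass `P`-function:
`h z = Σ_{w ∈ Γ\{0}} (1/(z-w)² - 1/w²)`. -/
noncomputable def weierstrassTail (w₁ w₂ : ℂ) (z : ℂ) : ℂ :=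
  ∑' w : {w : ℂ // w ∈ latticeSet w₁ w₂ ∧ w ≠ 0}, (1 / (z - (w : ℂ)) ^ 2 - 1 / (w : ℂ) ^ 2)

/-- The period pair `(w₁, w₂)` attached to two complex numbers with non-real ratio. -/
noncomputable def periodPairOfRatio (w₁ w₂ : ℂ) (hw₂ : w₂ ≠ 0)
    (hratio : w₁ / w₂ ∉ Set.range ((↑) : ℝ → ℂ)) : PeriodPair where
  ω₁ := w₁
  ω₂ := w₂
  indep := by
    rw [LinearIndependent.pair_symm_iff, LinearIndependent.pair_iff' hw₂]
    intro a ha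
    exact hratio ⟨a, by rw [← ha, Complex.real_smul, mul_div_cancel_right₀ _ hw₂]⟩

/-- The lattice of a period pair, as a set, is `latticeSet`. -/
theorem mem_latticeSet_iff (L : PeriodPair) (z : ℂ) :
    z ∈ latticeSet L.ω₁ L.ω₂ ↔ z ∈ L.lattice := by
  simp only [latticeSet, Set.mem_ofPred_eq, PeriodPair.mem_lattice, eq_comm]

/-- The Weierstrass tail is Mathlib's `℘` with the summand at `0` removed. -/
theorem weierstrassTail_eq_weierstrassPExcept (L : PeriodPair) :
    weierstrassTail L.ω₁ L.ω₂ = L.weierstrassPExcept 0 := by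
  ext z
  let i : {w : ℂ // w ∈ latticeSet L.ω₁ L.ω₂ ∧ w ≠ 0} → L.lattice :=
    fun w ↦ ⟨w, (mem_latticeSet_iff L w).1 w.2.1⟩
  have hi : Function.Injective i := fun a b h ↦ by
    simpa [i, Subtype.ext_iff] using h
  rw [PeriodPair.weierstrassPExcept, ← hi.tsum_eq]
  · exact tsum_congr fun w ↦ (if_neg w.2.2).symm
  · intro l hl
    have hl₀ : (l : ℂ) ≠ 0 := fun h ↦ hl (if_pos h)
    exact ⟨⟨l, (mem_latticeSet_iff L l).2 l.2, hl₀⟩, rfl⟩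

theorem weierstrassTail_holomorphic_near_zero (w₁ w₂ : ℂ) (hw₁ : w₁ ≠ 0) (hw₂ : w₂ ≠ 0)
    (hratio : w₁ / w₂ ∉ Set.range ((↑) : ℝ → ℂ)) :
    (∃ U : Set ℂ, IsOpen U ∧ (0 : ℂ) ∈ U ∧ DifferentiableOn ℂ (weierstrassTail w₁ w₂) U) ∧
    weierstrassTail w₁ w₂ 0 = 0 := by
  let L := periodPairOfRatio w₁ w₂ hw₂ hratio
  have h : weierstrassTail w₁ w₂ = L.weierstrassPExcept 0 :=
    weierstrassTail_eq_weierstrassPExcept L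
  refine ⟨⟨(L.lattice \ {0})ᶜ, L.isOpen_compl_lattice_sdiff, by simp, ?_⟩, ?_⟩
  · exact h ▸ L.differentiableOn_weierstrassPExcept 0
  · simp [weierstrassTail]
end

section
/- Let w₁, w₂ be nonzero complex numbers with w₁/w₂ ∉ ℝ and Γ = {n·w₁ + m·w₂ : n, m ∈ ℤ}, and let P(z) = 1/z² + Σ_{w ∈ Γ\{0}} [1/(z−w)² − 1/w²]. Then there exist complex constants α and β (depending only on the lattice Γ) such that for every z ∈ ℂ with z ∉ Γ, (P′(z))² = 4·(P(z))³ − α·P(z) − β. -/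
/-- The classical Weierstrass `P`-function:
`P z = 1/z² + Σ_{w ∈ Γ\{0}} (1/(z-w)² - 1/w²)`. -/
noncomputable def weierstrassP (w₁ w₂ : ℂ) (z : ℂ) : ℂ :=
  1 / z ^ 2 +
    ∑' w : {w : ℂ // w ∈ latticeSet w₁ w₂ ∧ w ≠ 0}, (1 / (z - (w : ℂ)) ^ 2 - 1 / (w : ℂ) ^ 2)

/-- The period pair spanned by two complex numbers whose ratio is not real. -/
noncomputable def PeriodPair.ofRatioNotReal (w₁ w₂ : ℂ) (hw₂ : w₂ ≠ 0)
    (hratio : w₁ / w₂ ∉ Set.range ((↑) : ℝ → ℂ)) : PeriodPair where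
  ω₁ := w₁
  ω₂ := w₂
  indep := by
    rw [LinearIndependent.pair_symm_iff, LinearIndependent.pair_iff' hw₂]
    intro a h
    exact hratio ⟨a, by rw [← h, Complex.real_smul, mul_div_cancel_right₀ _ hw₂]⟩

theorem PeriodPair.mem_lattice_iff_mem_latticeSet (L : PeriodPair) (z : ℂ) :
    z ∈ L.lattice ↔ z ∈ latticeSet L.ω₁ L.ω₂ := by
  simp only [PeriodPair.mem_lattice, latticeSet, Set.mem_ofPred_eq, eq_comm]

theorem PeriodPair.weierstrassP_eq (L : PeriodPair) :
    _root_.weierstrassP L.ω₁ L.ω₂ = L.weierstrassP := by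
  funext z
  let e : {w : ℂ // w ∈ latticeSet L.ω₁ L.ω₂ ∧ w ≠ 0} ≃ ({0}ᶜ : Set L.lattice) :=
    { toFun := fun w => ⟨⟨w, (L.mem_lattice_iff_mem_latticeSet w).2 w.2.1⟩,
        fun h => w.2.2 (congrArg Subtype.val h)⟩
      invFun := fun l => ⟨l, (L.mem_lattice_iff_mem_latticeSet l).1 l.1.2,
        fun h => l.2 (Subtype.ext h)⟩
      left_inv := fun _ => rfl
      right_inv := fun _ => rfl }
  let f : L.lattice → ℂ := fun l => 1 / (z - l) ^ 2 - 1 / (l : ℂ) ^ 2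
  have hf : HasSum f (L.weierstrassP z) := L.hasSum_weierstrassP z
  have hsplit := hf.summable.tsum_subtype_add_tsum_subtype_compl {0}
  rw [hf.tsum_eq, tsum_singleton, ← e.tsum_eq] at hsplit
  rw [← hsplit, _root_.weierstrassP]
  simp [f, e]

theorem weierstrassP_differential_equation (w₁ w₂ : ℂ) (hw₁ : w₁ ≠ 0) (hw₂ : w₂ ≠ 0)
    (hratio : w₁ / w₂ ∉ Set.range ((↑) : ℝ → ℂ)) :
    ∃ α β : ℂ, ∀ z : ℂ, z ∉ latticeSet w₁ w₂ →
      (deriv (weierstrassP w₁ w₂) z) ^ 2 =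
        4 * (weierstrassP w₁ w₂ z) ^ 3 - α * weierstrassP w₁ w₂ z - β := by
  let L := PeriodPair.ofRatioNotReal w₁ w₂ hw₂ hratio
  refine ⟨L.g₂, L.g₃, fun z hz => ?_⟩
  have hP : weierstrassP w₁ w₂ = L.weierstrassP := L.weierstrassP_eq
  rw [hP, L.deriv_weierstrassP]
  exact L.derivWeierstrassP_sq z fun h => hz ((L.mem_lattice_iff_mem_latticeSet z).1 h)
end

section
/- Every biholomorphism of ℂ is an affine linear transformation: if f : ℂ → ℂ is holomorphic on all of ℂ and bijective, then there exist a, b ∈ ℂ with a ≠ 0 such that f(z) = a·z + b for all z ∈ ℂ. -/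
open Filter Topology Bornology

namespace Complex

/-- A bijective entire function is a homeomorphism of the plane. -/
lemma isHomeomorph_of_differentiable_of_bijective {f : ℂ → ℂ} (hf : Differentiable ℂ f)
    (hbij : Function.Bijective f) : IsHomeomorph f := by
  refine ⟨hf.continuous, ?_, hbij⟩
  have hana : AnalyticOnNhd ℂ f .univ := fun z _ => hf.analyticAt z
  refine hana.is_constant_or_isOpenMap.resolve_left ?_
  rintro ⟨w, hw⟩
  exact zero_ne_one (hbij.1 ((hw 0).trans (hw 1).symm))

/-- The derivative of a bijective entire function has no zeros. -/
lemma deriv_ne_zero_of_differentiable_of_bijective {f : ℂ → ℂ} (hf : Differentiable ℂ f)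
    (hbij : Function.Bijective f) (c : ℂ) : deriv f c ≠ 0 := by
  intro hc
  set e := (isHomeomorph_of_differentiable_of_bijective hf hbij).homeomorph f
  have he (z : ℂ) : e.symm (f z) = z := e.symm_apply_apply z
  have he' (z : ℂ) : f (e.symm z) = z := e.apply_symm_apply z
  have hana : AnalyticOnNhd ℂ (deriv f) .univ := fun z _ => (hf.analyticAt z).deriv
  rcases (hana c trivial).eventually_eq_zero_or_eventually_ne_zero with h | h
  · have hzero : deriv f = 0 := hana.eq_of_eventuallyEq (fun _ _ => analyticAt_const) h
    exact zero_ne_one (hbij.1 (is_const_of_deriv_eq_zero hf (congrFun hzero) 0 1))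
  · have htend : Tendsto e.symm (𝓝[≠] f c) (𝓝[≠] c) := by
      have := e.symm.continuous.continuousAt.tendsto (x := f c)
      rw [he] at this
      refine tendsto_nhdsWithin_iff.2 ⟨this.mono_left inf_le_left, ?_⟩
      filter_upwards [self_mem_nhdsWithin] with w hw hwc
      exact hw ((he' w).symm.trans (congrArg f hwc))
    have hdiff : DifferentiableAt ℂ e.symm (f c) := by
      refine (analyticAt_of_differentiable_on_punctured_nhds_of_continuousAt ?_
        e.symm.continuous.continuousAt).differentiableAt
      filter_upwards [htend.eventually h] with w hw
      exact (HasDerivAt.of_local_left_inverse e.symm.continuous.continuousAt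
        (hf _).hasDerivAt hw (Eventually.of_forall he')).differentiableAt
    have hcomp := hdiff.hasDerivAt.comp c (hf c).hasDerivAt
    have hid : e.symm ∘ f = id := funext he
    rw [hid, hc, mul_zero] at hcomp
    exact zero_ne_one (hcomp.unique (hasDerivAt_id c))

/-- Conjugating a bijective entire function fixing `0` by the inversion `z ↦ z⁻¹`
gives an entire function. -/
lemma differentiable_inv_comp_inv {g : ℂ → ℂ} (hg : Differentiable ℂ g)
    (hbij : Function.Bijective g) (hg0 : g 0 = 0) :
    Differentiable ℂ fun z => (g z⁻¹)⁻¹ := by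
  have hne (z : ℂ) (hz : z ≠ 0) : DifferentiableAt ℂ (fun z => (g z⁻¹)⁻¹) z := by
    refine ((hg _).comp z (differentiableAt_inv hz)).inv fun h => hz ?_
    exact inv_eq_zero.1 (hbij.1 (h.trans hg0.symm))
  intro z
  rcases eq_or_ne z 0 with rfl | hz
  · refine (analyticAt_of_differentiable_on_punctured_nhds_of_continuousAt ?_ ?_).differentiableAt
    · filter_upwards [self_mem_nhdsWithin] with w hw using hne w hw
    · have hcob : Tendsto g (cobounded ℂ) (cobounded ℂ) := by
        rw [Metric.cobounded_eq_cocompact]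
        have hhom := isHomeomorph_of_differentiable_of_bijective hg hbij
        exact hhom.isClosedEmbedding.tendsto_cocompact
      rw [← continuousWithinAt_compl_self, ContinuousWithinAt]
      simpa [hg0, Function.comp_def] using
        tendsto_inv₀_cobounded.comp (hcob.comp tendsto_inv₀_nhdsNE_zero)
  · exact hne z hz

/-- A bijective entire function fixing `0` is linear. -/
lemma eq_mul_of_differentiable_of_bijective {g : ℂ → ℂ} (hg : Differentiable ℂ g)
    (hbij : Function.Bijective g) (hg0 : g 0 = 0) : ∃ a : ℂ, ∀ z, g z = a * z := by
  set k : ℂ → ℂ := fun z => (g z⁻¹)⁻¹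
  have hk := differentiable_inv_comp_inv hg hbij hg0
  have hkbij : Function.Bijective k :=
    (inv_involutive.bijective.comp hbij).comp inv_involutive.bijective
  have hk' := deriv_ne_zero_of_differentiable_of_bijective hk hkbij 0
  have hslope : Tendsto (slope k 0) (𝓝[≠] 0) (𝓝 (deriv k 0)) :=
    hasDerivAt_iff_tendsto_slope.1 (hk 0).hasDerivAt
  have hlim : Tendsto (dslope g 0) (cocompact ℂ) (𝓝 (deriv k 0)⁻¹) := by
    rw [← Metric.cobounded_eq_cocompact]
    refine ((hslope.comp tendsto_inv₀_cobounded').inv₀ hk').congr' ?_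
    filter_upwards [eventually_ne_cobounded (0 : ℂ)] with w hw
    simp [dslope_of_ne _ hw, slope_def_field, k, hg0, div_eq_mul_inv, mul_comm]
  have hd : Differentiable ℂ (dslope g 0) := by
    rw [← differentiableOn_univ, differentiableOn_dslope univ_mem]
    exact hg.differentiableOn
  refine ⟨(deriv k 0)⁻¹, fun z => ?_⟩
  have hz := sub_smul_dslope g 0 z
  rw [hd.apply_eq_of_tendsto_cocompact z hlim] at hz
  simpa [hg0, mul_comm] using hz.symm

end Complex

theorem biholomorphism_of_C_is_affine (f : ℂ → ℂ) (hf : Differentiable ℂ f)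
    (hbij : Function.Bijective f) :
    ∃ a b : ℂ, a ≠ 0 ∧ ∀ z : ℂ, f z = a * z + b := by
  obtain ⟨a, ha⟩ := Complex.eq_mul_of_differentiable_of_bijective (hf.sub_const (f 0))
    ((Equiv.subRight (f 0)).bijective.comp hbij) (sub_self _)
  have haff (z : ℂ) : f z = a * z + f 0 := sub_eq_iff_eq_add.1 (ha z)
  refine ⟨a, f 0, ?_, haff⟩
  rintro rfl
  exact one_ne_zero (hbij.1 (by simpa using haff 1))
end
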